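/- arXiv:2601.08407 — 8 statements merged into one kernel-verified Lean document; each statement's English description precedes it below -/
import Mathlib

section
/- Let X be a compact metric space and f : X → X a continuous map. For every shadowable point x of f, the following are equivalent: (i) x is an upper semicontinuity point of the ω-limit set map ω_f; (ii) ω_f(x) = Ω_f(x). -/
open Filter Topology

variable {X : Type*} [MetricSpace X]

/-- The ω-limit set of `x` under `f`: points `y` with `f^[φ j] x → y` for some
strictly increasing sequence `φ`. -/
def omegaLimitPt (f : X → X) (x : X) : Set X :=
  {y | ∃ φ : ℕ → ℕ, StrictMono φ ∧ Tendsto (fun j => f^[φ j] x) atTop (𝓝 y)}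

/-- The set `Ω_f(x)`: points `y` such that there are `x_j → x` and a strictly
increasing sequence `φ` with `f^[φ j] (x_j) → y`. -/
def bigOmega (f : X → X) (x : X) : Set X :=
  {y | ∃ (xs : ℕ → X) (φ : ℕ → ℕ), StrictMono φ ∧
    Tendsto xs atTop (𝓝 x) ∧ Tendsto (fun j => f^[φ j] (xs j)) atTop (𝓝 y)}

/-- `x` is a shadowable point for `f`. -/
def ShadowablePoint (f : X → X) (x : X) : Prop :=
  ∀ ε > 0, ∃ δ > 0, ∀ xs : ℕ → X, (∀ i, dist (f (xs i)) (xs (i + 1)) ≤ δ) →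
    xs 0 = x → ∃ y, ∀ i, dist (xs i) (f^[i] y) ≤ ε

/-- `x` is an upper semicontinuity point of the ω-limit set map. -/
def USCPoint (f : X → X) (x : X) : Prop :=
  ∀ U : Set X, IsOpen U → omegaLimitPt f x ⊆ U →
    ∃ δ > 0, ∀ y, dist x y ≤ δ → omegaLimitPt f y ⊆ U

/-- `x` is a lower semicontinuity point of the ω-limit set map. -/
def LSCPoint (f : X → X) (x : X) : Prop :=
  ∀ U : Set X, IsOpen U → (omegaLimitPt f x ∩ U).Nonempty →
    ∃ δ > 0, ∀ y, dist x y ≤ δ → (omegaLimitPt f y ∩ U).Nonempty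

/-- `(c i)_{i=0}^k` is a `δ`-chain of `f` (with `k ≥ 1`). -/
def IsDeltaChain (f : X → X) (δ : ℝ) (c : ℕ → X) (k : ℕ) : Prop :=
  1 ≤ k ∧ ∀ i < k, dist (f (c i)) (c (i + 1)) ≤ δ

/-- `y → z`: for every `δ > 0` there is a `δ`-chain of `f` from `y` to `z`. -/
def ChainReach (f : X → X) (y z : X) : Prop :=
  ∀ δ > 0, ∃ (c : ℕ → X) (k : ℕ), IsDeltaChain f δ c k ∧ c 0 = y ∧ c k = z

/-- A set `S` is chain stable: `y ∈ S` and `y → z` imply `z ∈ S`. -/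
def ChainStable (f : X → X) (S : Set X) : Prop :=
  ∀ y ∈ S, ∀ z, ChainReach f y z → z ∈ S

/-- The set `ω_f*(x)`: points reachable from `x` by arbitrarily fine and
arbitrarily long `δ`-chains. -/
def omegaStar (f : X → X) (x : X) : Set X :=
  {y | ∀ δ > 0, ∀ l : ℕ, 1 ≤ l → ∃ (c : ℕ → X) (k : ℕ),
    l ≤ k ∧ IsDeltaChain f δ c k ∧ c 0 = x ∧ c k = y}

/-- The chain component of a point `p`. -/
def chainComponent (f : X → X) (p : X) : Set X :=
  {q | ChainReach f p q ∧ ChainReach f q p}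

/-- `f` is chain continuous at `x`. -/
def ChainContinuousAt (f : X → X) (x : X) : Prop :=
  ∀ ε > 0, ∃ δ > 0, ∀ xs : ℕ → X, (∀ i, dist (f (xs i)) (xs (i + 1)) ≤ δ) →
    xs 0 = x → ∀ i, dist (xs i) (f^[i] x) ≤ ε

/-- The chain recurrent set `CR(f)`. -/
def chainRecurrent (f : X → X) : Set X := {x | ChainReach f x x}

/-- `x` is a regularly recurrent point for `f`. -/
def RegularlyRecurrent (f : X → X) (x : X) : Prop :=
  ∀ ε > 0, ∃ k : ℕ, 1 ≤ k ∧ ∀ j : ℕ, dist x (f^[j * k] x) ≤ ε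

/-- `M` is a minimal set for `f`. -/
def IsMinimalSet (f : X → X) (M : Set X) : Prop :=
  M.Nonempty ∧ IsClosed M ∧ f '' M ⊆ M ∧ ∀ y ∈ M, omegaLimitPt f y = M

lemma mem_omegaLimitPt_iff {f : X → X} {x y : X} :
    y ∈ omegaLimitPt f x ↔ MapClusterPt y atTop (fun n => f^[n] x) := by
  constructor
  · rintro ⟨φ, hφ, h⟩
    exact MapClusterPt.of_comp hφ.tendsto_atTop h.mapClusterPt
  · intro h
    exact h.tendsto_subseq

lemma exists_ge_dist_lt_of_mapClusterPt {u : ℕ → X} {y : X} (h : MapClusterPt y atTop u)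
    {ε : ℝ} (hε : 0 < ε) (N : ℕ) : ∃ n ≥ N, dist (u n) y < ε :=
  frequently_atTop.1 (h.frequently (Metric.ball_mem_nhds y hε)) N

lemma mem_bigOmega_iff {f : X → X} {x y : X} :
    y ∈ bigOmega f x ↔
      ∀ N : ℕ, ∀ η > 0, ∃ m ≥ N, ∃ z, dist z x < η ∧ dist (f^[m] z) y < η := by
  constructor
  · rintro ⟨xs, φ, hφ, hxs, hy⟩ N η hη
    obtain ⟨j, hj, hjx, hjy⟩ := ((eventually_ge_atTop N).and
      ((hxs.eventually (Metric.ball_mem_nhds x hη)).and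
        (hy.eventually (Metric.ball_mem_nhds y hη)))).exists
    exact ⟨φ j, hj.trans (hφ.id_le j), xs j, hjx, hjy⟩
  · intro h
    obtain ⟨φ, hφ, hP⟩ := extraction_forall_of_frequently
      (P := fun n k => ∃ z, dist z x < 1 / ((n : ℝ) + 1) ∧ dist (f^[k] z) y < 1 / ((n : ℝ) + 1))
      (fun n => frequently_atTop.2 fun N => h N _ Nat.one_div_pos_of_nat)
    choose xs hxs hy using hP
    refine ⟨xs, φ, hφ, ?_, ?_⟩
    · exact tendsto_iff_dist_tendsto_zero.2 (squeeze_zero (fun _ => dist_nonneg)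
        (fun n => (hxs n).le) tendsto_one_div_add_atTop_nhds_zero_nat)
    · exact tendsto_iff_dist_tendsto_zero.2 (squeeze_zero (fun _ => dist_nonneg)
        (fun n => (hy n).le) tendsto_one_div_add_atTop_nhds_zero_nat)

lemma omegaLimitPt_subset_bigOmega (f : X → X) (x : X) : omegaLimitPt f x ⊆ bigOmega f x :=
  fun _ ⟨φ, hφ, h⟩ => ⟨fun _ => x, φ, hφ, tendsto_const_nhds, h⟩

/-- If `ω_f(x) = Ω_f(x)`, then `x` is an upper semicontinuity point of `ω_f`. -/
lemma uscPoint_of_omegaLimitPt_eq_bigOmega [CompactSpace X] {f : X → X} {x : X}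
    (h : omegaLimitPt f x = bigOmega f x) : USCPoint f x := by
  intro U hU hsub
  by_contra! hcon
  choose y hy hyU using fun n : ℕ => hcon (1 / ((n : ℝ) + 1)) Nat.one_div_pos_of_nat
  choose z hz hzU using fun n => Set.not_subset.1 (hyU n)
  obtain ⟨w, hwU, hw⟩ := hU.isClosed_compl.isCompact.exists_mapClusterPt_of_frequently
    (l := atTop) (f := z) (Frequently.of_forall hzU)
  refine hwU (hsub (h ▸ mem_bigOmega_iff.2 fun N η hη => ?_))
  obtain ⟨K, hK⟩ := exists_nat_one_div_lt hη
  obtain ⟨n, hn, hnw⟩ := exists_ge_dist_lt_of_mapClusterPt hw (half_pos hη) K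
  obtain ⟨m, hm, hmz⟩ := exists_ge_dist_lt_of_mapClusterPt (mem_omegaLimitPt_iff.1 (hz n))
    (half_pos hη) N
  refine ⟨m, hm, y n, ?_, ?_⟩
  · rw [dist_comm]
    exact (hy n).trans_lt ((Nat.one_div_le_one_div hn).trans_lt hK)
  · linarith [dist_triangle (f^[m] (y n)) (z n) w]

/-- A nontrivial chain of a relation, as a sequence. -/
lemma Relation.TransGen.exists_seq {α : Type*} {R : α → α → Prop} {a b : α}
    (h : Relation.TransGen R a b) :
    ∃ (c : ℕ → α) (k : ℕ), 1 ≤ k ∧ (∀ i < k, R (c i) (c (i + 1))) ∧ c 0 = a ∧ c k = b := by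
  induction h with
  | @single b h =>
    refine ⟨fun n => if n = 0 then a else b, 1, le_rfl, fun i hi => ?_, by simp, by simp⟩
    obtain rfl : i = 0 := by omega
    simpa using h
  | @tail b d _ h ih =>
    obtain ⟨c, k, hk, hc, h0, hb⟩ := ih
    refine ⟨fun n => if n ≤ k then c n else d, k + 1, by omega, fun i hi => ?_, by simpa, by simp⟩
    rcases Nat.lt_succ_iff_lt_or_eq.1 hi with hi | rfl
    · simpa [hi.le, Nat.succ_le_iff.2 hi] using hc i hi
    · simpa [hb] using h

/-- If `a` reaches `b` and `b` reaches itself, some infinite chain from `a` visits `b`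
infinitely often. -/
lemma Relation.TransGen.exists_seq_frequently {α : Type*} {R : α → α → Prop} {a b : α}
    (hab : Relation.TransGen R a b) (hbb : Relation.TransGen R b b) :
    ∃ s : ℕ → α, s 0 = a ∧ (∀ i, R (s i) (s (i + 1))) ∧ ∃ᶠ n in atTop, s n = b := by
  obtain ⟨e, l, hl, he, he0, hel⟩ := hab.exists_seq
  obtain ⟨c, k, hk, hc, hc0, hck⟩ := hbb.exists_seq
  refine ⟨fun n => if n < l then e n else c ((n - l) % k), ?_, fun i => ?_, ?_⟩
  · simp [he0, Nat.lt_of_succ_le hl]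
  · rcases lt_trichotomy (i + 1) l with hi | hi | hi
    · simpa [hi, (Nat.lt_succ_self i).trans hi] using he i (by omega)
    · subst hi
      simpa [hc0, hel] using he i (by omega)
    · have h1 : ¬ i < l := by omega
      have h2 : ¬ i + 1 < l := by omega
      have h3 : i + 1 - l = (i - l) + 1 := by omega
      have hlt : (i - l) % k < k := Nat.mod_lt _ hk
      have hstep := hc _ hlt
      simp only [h1, h2, if_false, h3]
      rcases Nat.lt_or_ge ((i - l) % k + 1) k with h | h
      · rwa [Nat.add_mod_of_add_mod_lt (by rwa [Nat.mod_eq_of_lt (a := 1) (by omega)]),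
          Nat.mod_eq_of_lt (a := 1) (by omega)]
      · have h4 : (i - l) % k + 1 = k := by omega
        have h5 : ((i - l) + 1) % k = 0 := by
          rw [← Nat.mod_add_mod, h4, Nat.mod_self]
        rw [h5, hc0, ← hck]
        rwa [h4] at hstep
  · refine frequently_atTop.2 fun N => ⟨l + k * N, ?_, ?_⟩
    · nlinarith
    · simp [hc0]

lemma transGen_of_dist_iterate_le {f : X → X} {δ : ℝ} (hδ : 0 ≤ δ) {p q z : X} (m : ℕ)
    (hp : dist (f p) (f z) ≤ δ) (hq : dist (f^[m + 2] z) q ≤ δ) :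
    Relation.TransGen (fun a b => dist (f a) b ≤ δ) p q := by
  have horbit : ∀ n, Relation.TransGen (fun a b => dist (f a) b ≤ δ) p (f^[n + 1] z) := by
    intro n
    induction n with
    | zero => exact .single hp
    | succ n ih =>
      refine ih.tail ?_
      rw [Function.iterate_succ_apply' f (n + 1), dist_self]
      exact hδ
  refine (horbit m).tail ?_
  rwa [← Function.iterate_succ_apply' f]

/-- At an upper semicontinuity point of `ω_f`, every point of `Ω_f(x)` is reachable from `x` and
from itself by arbitrarily fine chains. -/
lemma USCPoint.transGen_of_mem_bigOmega [CompactSpace X] {f : X → X} (hf : Continuous f) {x y : X}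
    (hx : USCPoint f x) (hy : y ∈ bigOmega f x) {δ : ℝ} (hδ : 0 < δ) :
    Relation.TransGen (fun a b => dist (f a) b ≤ δ) x y ∧
      Relation.TransGen (fun a b => dist (f a) b ≤ δ) y y := by
  rw [mem_bigOmega_iff] at hy
  obtain ⟨η₀, hη₀, hunif⟩ := Metric.uniformContinuous_iff.1
    (CompactSpace.uniformContinuous_of_continuous hf) δ hδ
  obtain ⟨η, hη, hηη₀, hηδ⟩ : ∃ η > 0, η ≤ η₀ ∧ η ≤ δ :=
    ⟨min η₀ δ, lt_min hη₀ hδ, min_le_left _ _, min_le_right _ _⟩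
  have hfη : ∀ {a b : X}, dist a b < η → dist (f b) (f a) ≤ δ := fun {a b} h => by
    rw [dist_comm]
    exact (hunif (h.trans_le hηη₀)).le
  constructor
  · obtain ⟨m, hm, z, hzx, hzy⟩ := hy 2 η hη
    obtain ⟨m, rfl⟩ := Nat.exists_eq_add_of_le' hm
    exact transGen_of_dist_iterate_le hδ.le m (hfη hzx) (hzy.le.trans hηδ)
  obtain ⟨r, hr, hsub⟩ := hx (Metric.thickening (η / 2) (omegaLimitPt f x))
    Metric.isOpen_thickening (Metric.self_subset_thickening (half_pos hη) _)
  obtain ⟨q, hq, hyq⟩ : ∃ q ∈ omegaLimitPt f x,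
      Relation.TransGen (fun a b => dist (f a) b ≤ δ) y q := by
    obtain ⟨m, -, z, hzx, hzy⟩ := hy 0 (min η r) (lt_min hη hr)
    obtain ⟨w, -, hw⟩ := isCompact_univ.exists_mapClusterPt_of_frequently (l := atTop)
      (f := fun n => f^[n] z) (Frequently.of_forall fun _ => Set.mem_univ _)
    obtain ⟨q, hq, hwq⟩ := Metric.mem_thickening_iff.1 (hsub z
      (by rw [dist_comm]; exact (hzx.trans_le (min_le_right _ _)).le) (mem_omegaLimitPt_iff.2 hw))
    obtain ⟨n, hn, hnw⟩ := exists_ge_dist_lt_of_mapClusterPt hw (half_pos hη) (2 + m)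
    obtain ⟨n, rfl⟩ := Nat.exists_eq_add_of_le' hn
    refine ⟨q, hq, transGen_of_dist_iterate_le (z := f^[m] z) hδ.le n
      (hfη (hzy.trans_le (min_le_left _ _))) ?_⟩
    rw [← Function.iterate_add_apply, add_assoc]
    linarith [dist_triangle (f^[n + (2 + m)] z) w q]
  refine hyq.trans ?_
  obtain ⟨n, -, hn⟩ :=
    exists_ge_dist_lt_of_mapClusterPt (mem_omegaLimitPt_iff.1 hq) (half_pos hη) 0
  obtain ⟨r', hr', hcont⟩ := Metric.continuous_iff.1 (hf.iterate n) x (η / 2) (half_pos hη)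
  obtain ⟨m, hm, z, hzx, hzy⟩ := hy (2 + n) (min η r') (lt_min hη hr')
  obtain ⟨m, rfl⟩ := Nat.exists_eq_add_of_le' hm
  have hzn := hcont z (hzx.trans_le (min_le_right _ _))
  refine transGen_of_dist_iterate_le (z := f^[n] z) hδ.le m (hfη ?_) ?_
  · linarith [dist_triangle (f^[n] z) (f^[n] x) q]
  · rw [← Function.iterate_add_apply, add_assoc]
    exact hzy.le.trans ((min_le_left _ _).trans hηδ)

/-- At a shadowable upper semicontinuity point of `ω_f`, `Ω_f(x) ⊆ ω_f(x)`. -/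
lemma ShadowablePoint.bigOmega_subset_omegaLimitPt [CompactSpace X] {f : X → X}
    (hf : Continuous f) {x : X} (hx : ShadowablePoint f x) (husc : USCPoint f x) :
    bigOmega f x ⊆ omegaLimitPt f x := by
  intro y hy
  have hclosed : IsClosed (omegaLimitPt f x) := by
    have : omegaLimitPt f x = {y | ClusterPt y (map (fun n => f^[n] x) atTop)} :=
      Set.ext fun _ => mem_omegaLimitPt_iff
    rw [this]
    exact isClosed_setOfPred_clusterPt
  by_contra hyω
  obtain ⟨ε, hε, hball⟩ := Metric.nhds_basis_closedBall.mem_iff.1 (hclosed.isOpen_compl.mem_nhds hyω)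
  obtain ⟨r, hr, hsub⟩ := husc (Metric.closedBall y ε)ᶜ Metric.isClosed_closedBall.isOpen_compl
    (Set.subset_compl_comm.1 hball)
  obtain ⟨δ, hδ, hshadow⟩ := hx (min ε r) (lt_min hε hr)
  obtain ⟨hxy, hyy⟩ := husc.transGen_of_mem_bigOmega hf hy hδ
  obtain ⟨s, hs0, hs, hsy⟩ := hxy.exists_seq_frequently hyy
  obtain ⟨w, hw⟩ := hshadow s hs hs0
  obtain ⟨v, hvy, hv⟩ :=
    Metric.isClosed_closedBall.isCompact.exists_mapClusterPt_of_frequently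
      (s := Metric.closedBall y ε) (l := atTop) (f := fun n => f^[n] w)
      (hsy.mono fun n hn => by
        rw [Metric.mem_closedBall, dist_comm, ← hn]
        exact (hw n).trans (min_le_left _ _))
  have hxw : dist x w ≤ r := by
    simpa [hs0] using (hw 0).trans (min_le_right _ _)
  exact hsub w hxw (mem_omegaLimitPt_iff.2 hv) hvy

theorem stmt0 [CompactSpace X] (f : X → X) (hf : Continuous f) (x : X)
    (hx : ShadowablePoint f x) :
    USCPoint f x ↔ omegaLimitPt f x = bigOmega f x :=
  ⟨fun h => (omegaLimitPt_subset_bigOmega f x).antisymm (hx.bigOmega_subset_omegaLimitPt hf h),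
    uscPoint_of_omegaLimitPt_eq_bigOmega⟩
end

section
/- Let X be a compact metric space and f : X → X a continuous map. Every point x ∈ X with ω_f(x) = Ω_f(x) is an upper semicontinuity point of the ω-limit set map ω_f. -/
open Filter Topology

variable {X : Type*} [MetricSpace X]

theorem frequently_dist_iterate_lt {f : X → X} {y z : X} (hz : z ∈ omegaLimitPt f y)
    {ε : ℝ} (hε : 0 < ε) : ∃ᶠ i in atTop, dist (f^[i] y) z < ε := by
  obtain ⟨φ, hφ, hlim⟩ := hz
  exact hφ.tendsto_atTop.frequently (Metric.tendsto_nhds.1 hlim ε hε).frequently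

theorem stmt1 [CompactSpace X] (f : X → X) (hf : Continuous f) (x : X)
    (hx : omegaLimitPt f x = bigOmega f x) :
    USCPoint f x := by
  intro U hU hsub
  by_contra! hcon
  have hpos (n : ℕ) : (0 : ℝ) < 1 / ((n : ℝ) + 1) := Nat.one_div_pos_of_nat
  choose y hy hyU using fun n : ℕ => hcon _ (hpos n)
  choose z hzy hzU using fun n => Set.not_subset.1 (hyU n)
  obtain ⟨w, -, ψ, hψ, hw⟩ := isCompact_univ.tendsto_subseq fun n => Set.mem_univ (z n)
  obtain ⟨φ, hφ, hdist⟩ := extraction_forall_of_frequently fun n =>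
    frequently_dist_iterate_lt (hzy (ψ n)) (hpos (ψ n))
  have hε : Tendsto (fun n => 1 / ((ψ n : ℝ) + 1)) atTop (𝓝 0) :=
    (tendsto_one_div_add_atTop_nhds_zero_nat (𝕜 := ℝ)).comp hψ.tendsto_atTop
  have hwU : w ∉ U :=
    hU.isClosed_compl.mem_of_tendsto hw (Eventually.of_forall fun n => hzU (ψ n))
  refine hwU (hsub (hx ▸ ⟨fun n => y (ψ n), φ, hφ, ?_, ?_⟩))
  · refine tendsto_iff_dist_tendsto_zero.2 (squeeze_zero (fun _ => dist_nonneg) (fun n => ?_) hε)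
    rw [dist_comm]
    exact hy (ψ n)
  · refine (tendsto_iff_of_dist ?_).2 hw
    exact squeeze_zero (fun _ => dist_nonneg) (fun n => (hdist n).le) hε
end

section
/- Let X be a compact metric space and f : X → X a continuous map. If x is both a shadowable point for f and a lower semicontinuity point of the ω-limit set map ω_f, then ω_f(x) ⊆ ω_f(y) for every y ∈ Ω_f(x). -/
open Filter Topology

variable {X : Type*} [MetricSpace X]

theorem mem_omegaLimitPt_iff_s6 {f : X → X} {x p : X} :
    p ∈ omegaLimitPt f x ↔ ∀ r > 0, ∀ N : ℕ, ∃ n ≥ N, dist (f^[n] x) p < r := by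
  constructor
  · rintro ⟨φ, hφ, hlim⟩ r hr N
    obtain ⟨M, hM⟩ := Metric.tendsto_atTop.1 hlim r hr
    exact ⟨φ (max M N), (le_max_right M N).trans hφ.le_apply, hM _ (le_max_left M N)⟩
  · intro h
    have hc : MapClusterPt p atTop (fun n => f^[n] x) := by
      rw [Metric.nhds_basis_ball.mapClusterPt_iff_frequently]
      exact fun r hr => frequently_atTop.2 (h r hr)
    exact hc.tendsto_subseq

/-- The orbit of `w` with its initial point replaced by `x`, switching to the orbit of `y` at
time `n`, is a pseudo orbit whose errors are controlled by the two jumps. -/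
theorem exists_pseudoOrbit_splice (f : X → X) (x w y : X) {n : ℕ} (hn : 1 ≤ n) {δ : ℝ}
    (hx : dist (f x) (f w) ≤ δ / 2) (hy : dist (f^[n] w) y ≤ δ / 2) :
    ∃ xs : ℕ → X, (∀ i, dist (f (xs i)) (xs (i + 1)) ≤ δ) ∧ xs 0 = x ∧
      ∀ i, xs (n + i) = f^[i] y := by
  have hδ : 0 ≤ δ / 2 := dist_nonneg.trans hx
  refine ⟨fun i => if i = 0 then x else if i < n then f^[i] w else f^[i - n] y, ?_, by simp, ?_⟩
  · intro i
    simp only [Nat.add_eq_zero_iff, one_ne_zero, and_false, if_false]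
    rcases Nat.eq_zero_or_pos i with rfl | hi
    · rcases hn.eq_or_lt with rfl | hn
      · simp only [Function.iterate_one] at hy
        simpa using (dist_triangle (f x) (f w) y).trans (by linarith)
      · simp only [zero_add, if_true, hn, Function.iterate_one]
        linarith
    · rw [if_neg hi.ne']
      rcases lt_trichotomy (i + 1) n with h | h | h
      · rw [if_pos (by omega), if_pos h, Function.iterate_succ_apply', dist_self]
        linarith
      · rw [if_pos (by omega), if_neg (by omega), ← Function.iterate_succ_apply' f, Nat.succ_eq_add_one, h,
          Nat.sub_self, Function.iterate_zero, id]
        linarith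
      · rw [if_neg (by omega), if_neg (by omega), show i + 1 - n = (i - n) + 1 by omega,
          Function.iterate_succ_apply', dist_self]
        linarith
  · intro i
    have h0 : ¬ (n + i = 0) := by omega
    simp only [if_neg h0, if_neg (show ¬ n + i < n by omega), Nat.add_sub_cancel_left]

theorem stmt6 [CompactSpace X] (f : X → X) (hf : Continuous f) (x : X)
    (hsh : ShadowablePoint f x) (hlsc : LSCPoint f x) :
    ∀ y ∈ bigOmega f x, omegaLimitPt f x ⊆ omegaLimitPt f y := by
  rintro y ⟨w, φ, hφ, hw, hwy⟩ p hp
  rw [mem_omegaLimitPt_iff_s6]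
  intro r hr N
  obtain ⟨η, hη, hlsc⟩ := hlsc (Metric.ball p (r / 3)) Metric.isOpen_ball
    ⟨p, hp, Metric.mem_ball_self (by linarith)⟩
  obtain ⟨δ, hδ, hsh⟩ := hsh (min η (r / 3)) (lt_min hη (by linarith))
  have hfw : ∀ᶠ j in atTop, dist (f (w j)) (f x) < δ / 2 :=
    Metric.tendsto_nhds.1 ((hf.tendsto x).comp hw) _ (half_pos hδ)
  obtain ⟨j, hjx, hjy, hj⟩ := (hfw.and ((Metric.tendsto_nhds.1 hwy _ (half_pos hδ)).and
    (eventually_ge_atTop 1))).exists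
  rw [dist_comm] at hjx
  obtain ⟨xs, hxs, hxs0, hxsy⟩ :=
    exists_pseudoOrbit_splice f x (w j) y (hj.trans hφ.le_apply) hjx.le hjy.le
  obtain ⟨z, hz⟩ := hsh xs hxs hxs0
  have hxz : dist x z ≤ η := by
    simpa [hxs0] using (hz 0).trans (min_le_left _ _)
  obtain ⟨q, hq, hqp⟩ := hlsc z hxz
  obtain ⟨m, hm, hmq⟩ := mem_omegaLimitPt_iff_s6.1 hq (r / 3) (by linarith) (φ j + N)
  obtain ⟨k, rfl⟩ := Nat.exists_eq_add_of_le ((Nat.le_add_right _ N).trans hm)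
  refine ⟨k, by omega, ?_⟩
  have hk := (hz (φ j + k)).trans (min_le_right _ _)
  rw [hxsy] at hk
  rw [Metric.mem_ball] at hqp
  have := dist_triangle4 (f^[k] y) (f^[φ j + k] z) q p
  linarith
end

section
/- Let X be a compact metric space and f : X → X a continuous map. If x is both a shadowable point for f and a lower semicontinuity point of the ω-limit set map ω_f, then y → z for all y, z ∈ ω_f*(x). -/
open Filter Topology

variable {X : Type*} [MetricSpace X]

theorem omegaLimitPt_nonempty [CompactSpace X] (f : X → X) (x : X) :
    (omegaLimitPt f x).Nonempty := by
  obtain ⟨p, -, φ, hφ, hlim⟩ :=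
    isCompact_univ.tendsto_subseq (x := fun n => f^[n] x) fun _ => Set.mem_univ _
  exact ⟨p, φ, hφ, hlim⟩

theorem ChainReach.trans {f : X → X} {a b c : X} (hab : ChainReach f a b)
    (hbc : ChainReach f b c) : ChainReach f a c := by
  intro δ hδ
  obtain ⟨u, k, ⟨hk, hu⟩, hu0, huk⟩ := hab δ hδ
  obtain ⟨v, l, ⟨hl, hv⟩, hv0, hvl⟩ := hbc δ hδ
  refine ⟨fun i => if i < k then u i else v (i - k), k + l, ⟨by omega, fun i hi => ?_⟩, ?_, ?_⟩
  · rcases lt_trichotomy (i + 1) k with h | h | h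
    · simpa [h, (by omega : i < k)] using hu i (by omega)
    · have := hu i (by omega)
      rw [h, huk, ← hv0] at this
      simpa [h, (by omega : i < k)] using this
    · have := hv (i - k) (by omega)
      rw [← Nat.sub_add_comm (by omega)] at this
      have h1 : ¬ i + 1 < k := by omega
      have h2 : ¬ i < k := by omega
      simpa only [if_neg h1, if_neg h2] using this
  · simpa [(by omega : 0 < k)] using hu0
  · simpa using hvl

/-- A finite chain starting at a shadowable point, continued by the true orbit of its last point,
is shadowed. -/
theorem ShadowablePoint.exists_shadow {f : X → X} {x : X} (h : ShadowablePoint f x) {ε : ℝ}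
    (hε : 0 < ε) : ∃ δ > 0, ∀ (c : ℕ → X) (k : ℕ), (∀ i < k, dist (f (c i)) (c (i + 1)) ≤ δ) →
      c 0 = x → ∃ w, (∀ i ≤ k, dist (c i) (f^[i] w) ≤ ε) ∧
        ∀ i, dist (f^[i] (c k)) (f^[k + i] w) ≤ ε := by
  obtain ⟨δ, hδ, hsh⟩ := h ε hε
  refine ⟨δ, hδ, fun c k hc hc0 => ?_⟩
  obtain ⟨w, hw⟩ := hsh (fun i => if i ≤ k then c i else f^[i - k] (c k)) (fun i => by
    rcases lt_trichotomy i k with h | rfl | h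
    · simpa [h.le, Nat.succ_le_of_lt h] using hc i h
    · simpa using hδ.le
    · have : i + 1 - k = (i - k) + 1 := by omega
      have h1 : ¬ i ≤ k := by omega
      have h2 : ¬ i + 1 ≤ k := by omega
      simpa only [if_neg h1, if_neg h2, this, Function.iterate_succ_apply', dist_self] using hδ.le) (by simpa using hc0)
  refine ⟨w, fun i hi => by simpa [hi] using hw i, fun i => ?_⟩
  rcases Nat.eq_zero_or_pos i with rfl | hi
  · simpa using hw k
  · have h : ¬ k + i ≤ k := by omega
    simpa only [if_neg h, Nat.add_sub_cancel_left] using hw (k + i)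

/-- Points of `ω_f*(x)` chain-reach every point of `ω_f(x)`. -/
theorem chainReach_omegaLimitPt {f : X → X} {x y p : X} (hsh : ShadowablePoint f x)
    (hlsc : LSCPoint f x) (hy : y ∈ omegaStar f x) (hp : p ∈ omegaLimitPt f x) :
    ChainReach f y p := by
  intro δ hδ
  obtain ⟨r, hr, hrU⟩ := hlsc (Metric.ball p (δ / 3)) Metric.isOpen_ball
    ⟨p, hp, Metric.mem_ball_self (by positivity)⟩
  obtain ⟨η, hη, hshadow⟩ := hsh.exists_shadow (lt_min hr (by positivity : 0 < δ / 3))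
  obtain ⟨c, k, -, ⟨-, hc⟩, hc0, hck⟩ := hy η hη 1 le_rfl
  obtain ⟨w, hw, hw'⟩ := hshadow c k hc hc0
  have hxw : dist x w ≤ r := by simpa [hc0] using (hw 0 (Nat.zero_le k)).trans (min_le_left _ _)
  obtain ⟨q, ⟨φ, hφ, hq⟩, hqp⟩ := hrU w hxw
  obtain ⟨j, hj, hjk⟩ := ((hq.eventually (Metric.ball_mem_nhds q (by positivity : 0 < δ / 3))).and
    (hφ.tendsto_atTop.eventually_ge_atTop (k + 1))).exists
  obtain ⟨m, hm⟩ : ∃ m, φ j = k + (m + 1) := ⟨φ j - k - 1, by omega⟩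
  have hym := (hw' (m + 1)).trans (min_le_right _ _)
  rw [hck, ← hm] at hym
  have hyp : dist (f^[m + 1] y) p ≤ δ := by
    have h1 := dist_triangle4 (f^[m + 1] y) (f^[φ j] w) q p
    have h2 := Metric.mem_ball.1 hqp
    have h3 : dist (f^[φ j] w) q < δ / 3 := hj
    linarith
  refine ⟨fun i => if i ≤ m then f^[i] y else p, m + 1, ⟨by omega, fun i hi => ?_⟩,
    by simp, by simp⟩
  rcases Nat.lt_succ_iff_lt_or_eq.1 hi with h | rfl
  · simpa [h.le, Nat.succ_le_of_lt h, -Function.iterate_succ, Function.iterate_succ_apply']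
      using hδ.le
  · simpa [-Function.iterate_succ, Function.iterate_succ_apply'] using hyp

/-- Points of `ω_f(x)` chain-reach every point of `ω_f*(x)`. -/
theorem chainReach_of_mem_omegaLimitPt {f : X → X} {x p z : X} (hf : Continuous f)
    (hsh : ShadowablePoint f x) (hp : p ∈ omegaLimitPt f x) (hz : z ∈ omegaStar f x) :
    ChainReach f p z := by
  intro δ hδ
  have hδ3 : 0 < δ / 3 := by positivity
  obtain ⟨φ, -, hφ⟩ := hp
  obtain ⟨j, hj⟩ := (((hf.tendsto p).comp hφ).eventually (Metric.ball_mem_nhds _ hδ3)).exists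
  set N := φ j
  have hN : dist (f^[N + 1] x) (f p) < δ / 3 := by
    rw [Function.iterate_succ_apply']; exact hj
  obtain ⟨r, hr, hrN⟩ := Metric.continuous_iff.1 (hf.iterate (N + 1)) x (δ / 3) hδ3
  obtain ⟨η, hη, hshadow⟩ := hsh.exists_shadow (lt_min (half_pos hr) hδ3)
  obtain ⟨c, k, hNk, ⟨-, hc⟩, hc0, hck⟩ := hz (min δ η) (lt_min hδ hη) (N + 1) (by omega)
  obtain ⟨w, hw, -⟩ := hshadow c k (fun i hi => (hc i hi).trans (min_le_right _ _)) hc0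
  have hxw : dist x w ≤ r / 2 := by
    simpa [hc0] using (hw 0 (Nat.zero_le k)).trans (min_le_left _ _)
  have hwN : dist (f^[N + 1] w) (f^[N + 1] x) < δ / 3 := hrN w (by rw [dist_comm]; linarith)
  have hcN := (hw (N + 1) hNk).trans (min_le_right _ _)
  have hpc : dist (f p) (c (N + 1)) ≤ δ := by
    have := dist_triangle4 (c (N + 1)) (f^[N + 1] w) (f^[N + 1] x) (f p)
    rw [dist_comm]; linarith
  refine ⟨fun i => if i = 0 then p else c (N + i), k - N, ⟨by omega, fun i hi => ?_⟩, by simp, ?_⟩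
  · rcases Nat.eq_zero_or_pos i with rfl | h
    · simpa using hpc
    · simpa [h.ne', add_assoc] using (hc (N + i) (by omega)).trans (min_le_left _ _)
  · have h1 : k - N ≠ 0 := by omega
    have h2 : N + (k - N) = k := by omega
    simpa only [if_neg h1, h2] using hck

theorem stmt7 [CompactSpace X] (f : X → X) (hf : Continuous f) (x : X)
    (hsh : ShadowablePoint f x) (hlsc : LSCPoint f x) :
    ∀ y ∈ omegaStar f x, ∀ z ∈ omegaStar f x, ChainReach f y z := by
  intro y hy z hz
  obtain ⟨p, hp⟩ := omegaLimitPt_nonempty f x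
  exact (chainReach_omegaLimitPt hsh hlsc hy hp).trans
    (chainReach_of_mem_omegaLimitPt hf hsh hp hz)
end

section
/- Let X be a compact metric space and f : X → X a continuous map. Every chain recurrent point of f at which f is chain continuous is a regularly recurrent point, i.e., CR(f) ∩ CC(f) ⊆ RR(f). -/
open Filter Topology

variable {X : Type*} [MetricSpace X]

/-- A `δ`-chain closing up at its starting point extends periodically to a `δ`-pseudo orbit. -/
theorem IsDeltaChain.dist_periodic_le {f : X → X} {δ : ℝ} {c : ℕ → X} {k : ℕ}
    (h : IsDeltaChain f δ c k) (hc : c k = c 0) (i : ℕ) :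
    dist (f (c (i % k))) (c ((i + 1) % k)) ≤ δ := by
  have hlt : i % k < k := Nat.mod_lt i h.1
  have heq : c ((i + 1) % k) = c (i % k + 1) := by
    rw [← Nat.mod_add_mod]
    rcases Nat.lt_or_ge (i % k + 1) k with hk | hk
    · rw [Nat.mod_eq_of_lt hk]
    · rw [show i % k + 1 = k by omega, Nat.mod_self, hc]
  rw [heq]
  exact h.2 _ hlt

theorem stmt10 [CompactSpace X] (f : X → X) (hf : Continuous f) (x : X)
    (hcr : x ∈ chainRecurrent f) (hcc : ChainContinuousAt f x) :
    RegularlyRecurrent f x := by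
  intro ε hε
  obtain ⟨δ, hδ, hshadow⟩ := hcc ε hε
  obtain ⟨c, k, hchain, h0, hk⟩ := hcr δ hδ
  refine ⟨k, hchain.1, fun j => ?_⟩
  have h := hshadow (fun i => c (i % k)) (hchain.dist_periodic_le (hk.trans h0.symm))
    (by simpa using h0) (j * k)
  simpa [h0] using h
end

section
/- Let X be a connected compact metric space and f : X → X a continuous map. Then f is chain continuous at every point of X if and only if the set ⋂_{i≥0} f^i(X) is a singleton. -/
open Filter Topology

variable {X : Type*} [MetricSpace X]

/-- `w` is the `n`-th term of some infinite `δ`-pseudo orbit of `f` starting at `u`. -/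
def PseudoOrbitReach (f : X → X) (δ : ℝ) (n : ℕ) (u w : X) : Prop :=
  ∃ xs : ℕ → X, (∀ i, dist (f (xs i)) (xs (i + 1)) ≤ δ) ∧ xs 0 = u ∧ xs n = w

namespace PseudoOrbitReach

variable {f : X → X} {δ : ℝ} {u v w : X} {m n : ℕ}

theorem iterate (f : X → X) (hδ : 0 ≤ δ) (n : ℕ) (u : X) :
    PseudoOrbitReach f δ n u (f^[n] u) :=
  ⟨fun i => f^[i] u, fun i => by simpa [Function.iterate_succ_apply'] using hδ, rfl, rfl⟩

theorem trans (h₁ : PseudoOrbitReach f δ m u v) (h₂ : PseudoOrbitReach f δ n v w) :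
    PseudoOrbitReach f δ (m + n) u w := by
  obtain ⟨xs, hxs, hx0, hxm⟩ := h₁
  obtain ⟨ys, hys, hy0, hyn⟩ := h₂
  refine ⟨fun i => if i < m then xs i else ys (i - m), fun i => ?_, ?_, by simpa using hyn⟩
  · rcases lt_trichotomy (i + 1) m with h | h | h
    · simpa [h, (Nat.lt_succ_self i).trans h] using hxs i
    · subst h
      simpa [hy0, ← hxm] using hxs i
    · have h' : i + 1 - m = i - m + 1 := by omega
      simpa [show ¬ i < m by omega, show ¬ i + 1 < m by omega, h'] using hys (i - m)
  · rcases Nat.eq_zero_or_pos m with rfl | hm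
    · simp [hy0, ← hxm, hx0]
    · simp [hm, hx0]

theorem single (hδ : 0 ≤ δ) (h : dist (f u) w ≤ δ) : PseudoOrbitReach f δ 1 u w := by
  refine ⟨fun i => if i = 0 then u else f^[i - 1] w, fun i => ?_, by simp, by simp⟩
  rcases i with _ | i
  · simpa using h
  · simpa [← Function.iterate_succ_apply' f] using hδ

theorem of_dist_iterate_le (hδ : 0 ≤ δ) (hm : 0 < m) (h : dist (f^[m] u) w ≤ δ) :
    PseudoOrbitReach f δ m u w := by
  obtain ⟨k, rfl⟩ := Nat.exists_eq_add_of_lt hm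
  rw [zero_add] at h ⊢
  rw [Function.iterate_succ_apply'] at h
  exact (iterate f hδ k u).trans (single hδ h)

theorem mul_self (h : PseudoOrbitReach f δ m u u) (k : ℕ) (hδ : 0 ≤ δ) :
    PseudoOrbitReach f δ (k * m) u u := by
  induction k with
  | zero => simpa using iterate f hδ 0 u
  | succ k ih => simpa [Nat.succ_mul] using ih.trans h

end PseudoOrbitReach

theorem ChainContinuousAt.equicontinuousAt_iterate {f : X → X} (hf : Continuous f) {x : X}
    (h : ChainContinuousAt f x) : EquicontinuousAt (fun n : ℕ => f^[n]) x := by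
  rw [Metric.equicontinuousAt_iff_right]
  intro ε hε
  obtain ⟨δ, hδ, hx⟩ := h (ε / 2) (half_pos hε)
  filter_upwards [hf.continuousAt.eventually (Metric.ball_mem_nhds _ hδ),
    Metric.ball_mem_nhds x hε] with y hy hyx n
  rcases n with _ | n
  · simpa [dist_comm] using hyx
  have hstep : PseudoOrbitReach f δ 1 x (f y) :=
    .single hδ.le (by rw [dist_comm]; exact (Metric.mem_ball.1 hy).le)
  obtain ⟨xs, hxs, h0, hn⟩ := hstep.trans (.iterate f hδ.le n (f y))
  have := hx xs hxs h0 (1 + n)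
  rw [hn, ← Function.iterate_succ_apply, add_comm 1 n, dist_comm] at this
  exact this.trans_lt (half_lt_self hε)

/-- An equicontinuous sequence of self-maps of a compact metric space has two terms that are
uniformly close. -/
theorem exists_lt_forall_dist_lt_of_equicontinuous [CompactSpace X] {F : ℕ → X → X}
    (hF : Equicontinuous F) {δ : ℝ} (hδ : 0 < δ) :
    ∃ a b, a < b ∧ ∀ x, dist (F a x) (F b x) < δ := by
  let G : ℕ → BoundedContinuousFunction X X :=
    fun n => BoundedContinuousFunction.mkOfCompact ⟨F n, hF.continuous n⟩
  have hA : Equicontinuous ((↑) : Set.range G → X → X) := by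
    intro x U hU
    filter_upwards [hF x U hU] with y hy
    rintro ⟨_, n, rfl⟩
    exact hy n
  have hK := BoundedContinuousFunction.arzela_ascoli Set.univ isCompact_univ (Set.range G)
    (fun _ _ _ => Set.mem_univ _) hA
  obtain ⟨_, _, φ, hφ, hlim⟩ :=
    hK.tendsto_subseq (fun n => subset_closure (Set.mem_range_self n))
  obtain ⟨N, hN⟩ := Metric.cauchySeq_iff.1 hlim.cauchySeq δ hδ
  exact ⟨φ N, φ (N + 1), hφ N.lt_succ_self, fun x =>
    (BoundedContinuousFunction.dist_coe_le_dist x).trans_lt (hN N le_rfl (N + 1) N.le_succ)⟩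

/-- If every point of `g(X)` almost returns to itself after `m` steps, then connectedness lets a
pseudo orbit drift between any two points of `g(X)`, in a time that is a multiple of `m`. -/
theorem exists_pseudoOrbitReach_of_connected [ConnectedSpace X] {f g : X → X}
    (hg : Continuous g) {δ : ℝ} (hδ : 0 < δ) {m : ℕ} (hm : 0 < m)
    (hret : ∀ x, dist (f^[m] (g x)) (g x) ≤ δ / 2) (x y : X) :
    ∃ k, PseudoOrbitReach f δ (k * m) (g x) (g y) := by
  let S : Set X := {v | ∃ k, PseudoOrbitReach f δ (k * m) (g x) (g v)}
  have hnear : ∀ v, {w | dist (g v) (g w) < δ / 2} ∈ 𝓝 v := fun v =>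
    (continuous_const.dist hg).continuousAt.eventually_lt continuousAt_const
      (by simpa using half_pos hδ)
  have hstep : ∀ v w, dist (g v) (g w) < δ / 2 → v ∈ S → w ∈ S := by
    rintro v w hvw ⟨k, hk⟩
    refine ⟨k + 1, ?_⟩
    rw [Nat.succ_mul]
    refine hk.trans (.of_dist_iterate_le hδ.le hm ?_)
    linarith [dist_triangle (f^[m] (g v)) (g v) (g w), hret v]
  have hopen : IsOpen S := isOpen_iff_mem_nhds.2 fun v hv =>
    mem_of_superset (hnear v) fun w hw => hstep v w hw hv
  have hclosed : IsClosed S := ⟨isOpen_iff_mem_nhds.2 fun v hv =>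
    mem_of_superset (hnear v) fun w hw hwS =>
      hv (hstep w v (by rw [dist_comm]; exact hw) hwS)⟩
  have hS : S = Set.univ :=
    IsClopen.eq_univ ⟨hclosed, hopen⟩ ⟨x, 0, by simpa using .iterate f hδ.le 0 (g x)⟩
  exact hS.ge (Set.mem_univ y)

theorem iInter_iterate_image_subsingleton [CompactSpace X] [ConnectedSpace X] {f : X → X}
    (hf : Continuous f) (h : ∀ x, ChainContinuousAt f x) :
    (⋂ i : ℕ, f^[i] '' Set.univ).Subsingleton := by
  intro p hp q hq
  refine eq_of_forall_dist_le fun ε hε => ?_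
  obtain ⟨δ, hδ, hδp⟩ := h p (ε / 2) (half_pos hε)
  obtain ⟨a, b, hab, hclose⟩ := exists_lt_forall_dist_lt_of_equicontinuous
    (fun x => (h x).equicontinuousAt_iterate hf) (half_pos hδ)
  have hret : ∀ x, dist (f^[b - a] (f^[a] x)) (f^[a] x) ≤ δ / 2 := fun x => by
    rw [← Function.iterate_add_apply, Nat.sub_add_cancel hab.le, dist_comm]
    exact (hclose x).le
  obtain ⟨u, -, rfl⟩ := Set.mem_iInter.1 hp a
  obtain ⟨v, -, rfl⟩ := Set.mem_iInter.1 hq a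
  have hm : 0 < b - a := Nat.sub_pos_of_lt hab
  obtain ⟨k, xs, hxs, hx0, hxk⟩ :=
    exists_pseudoOrbitReach_of_connected (hf.iterate a) hδ hm hret u v
  obtain ⟨ys, hys, hy0, hyk⟩ := PseudoOrbitReach.mul_self
    (.of_dist_iterate_le hδ.le hm ((hret u).trans (half_le_self hδ.le))) k hδ.le
  have h₁ := hδp xs hxs hx0 (k * (b - a))
  have h₂ := hδp ys hys hy0 (k * (b - a))
  rw [hxk] at h₁
  rw [hyk] at h₂
  exact (dist_triangle_right _ _ _).trans (by linarith)

theorem antitone_iterate_image_univ {Y : Type*} (f : Y → Y) : Antitone fun i : ℕ => f^[i] '' Set.univ :=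
  antitone_nat_of_succ_le fun i => by
    rintro _ ⟨x, -, rfl⟩
    exact ⟨f x, trivial, rfl⟩

/-- Pseudo orbits stay close to true orbits for a bounded time, uniformly in the starting point. -/
theorem UniformContinuous.exists_forall_dist_iterate_le {f : X → X} (hf : UniformContinuous f)
    (n : ℕ) {ε : ℝ} (hε : 0 < ε) :
    ∃ δ > 0, ∀ xs : ℕ → X, (∀ i, dist (f (xs i)) (xs (i + 1)) ≤ δ) →
      ∀ i ≤ n, dist (xs i) (f^[i] (xs 0)) ≤ ε := by
  induction n generalizing ε with
  | zero => exact ⟨1, one_pos, fun xs _ i hi => by simpa [Nat.le_zero.1 hi] using hε.le⟩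
  | succ n ih =>
    obtain ⟨η, hη, hfη⟩ := Metric.uniformContinuous_iff.1 hf (ε / 2) (half_pos hε)
    obtain ⟨δ, hδ, hxs⟩ := ih (lt_min hε (half_pos hη))
    refine ⟨min δ (ε / 2), lt_min hδ (half_pos hε), fun xs hx i hi => ?_⟩
    have hn := hxs xs fun i => (hx i).trans (min_le_left _ _)
    rcases Nat.le_succ_iff.1 hi with hi | rfl
    · exact (hn i hi).trans (min_le_left _ _)
    · rw [Function.iterate_succ_apply']
      have h₁ := hfη (((hn n le_rfl).trans (min_le_right _ _)).trans_lt (half_lt_self hη))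
      have h₂ := (hx n).trans (min_le_right _ _)
      rw [dist_comm] at h₂
      exact (dist_triangle _ _ _).trans (by linarith)

theorem chainContinuousAt_of_iInter_eq_singleton [CompactSpace X] {f : X → X}
    (hf : Continuous f) {p : X} (hp : (⋂ i : ℕ, f^[i] '' Set.univ) = {p}) (x : X) :
    ChainContinuousAt f x := by
  intro ε hε
  have hcompact : ∀ i, IsCompact (f^[i] '' Set.univ) := fun i =>
    isCompact_univ.image (hf.iterate i)
  obtain ⟨N, hN⟩ := exists_subset_nhds_of_isCompact
    (antitone_iterate_image_univ f).directed_ge hcompact (U := Metric.ball p (ε / 3))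
    (fun y hy => by
      rw [hp, Set.mem_singleton_iff] at hy
      exact hy ▸ Metric.ball_mem_nhds p (by positivity))
  obtain ⟨δ, hδ, hshadow⟩ := (CompactSpace.uniformContinuous_of_continuous
    hf).exists_forall_dist_iterate_le N (show 0 < ε / 3 by positivity)
  refine ⟨δ, hδ, fun xs hxs hx0 i => ?_⟩
  rcases le_total i N with hi | hi
  · have := hshadow xs hxs i hi
    rw [hx0] at this
    linarith
  · obtain ⟨j, rfl⟩ := Nat.exists_eq_add_of_le hi
    have h₁ := hshadow (fun i => xs (i + j)) (fun i => by
      simpa [Nat.add_right_comm] using hxs (i + j)) N le_rfl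
    have h₂ := hN (Set.mem_image_of_mem f^[N] (Set.mem_univ (xs j)))
    have h₃ := hN (Set.mem_image_of_mem f^[N] (Set.mem_univ (f^[j] x)))
    rw [Metric.mem_ball] at h₂ h₃
    rw [Function.iterate_add_apply]
    simp only [zero_add] at h₁
    linarith [dist_triangle (xs (N + j)) (f^[N] (xs j)) (f^[N] (f^[j] x)),
      dist_triangle_right (f^[N] (xs j)) (f^[N] (f^[j] x)) p]

theorem stmt12 [CompactSpace X] [ConnectedSpace X] (f : X → X) (hf : Continuous f) :
    (∀ x : X, ChainContinuousAt f x) ↔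
      ∃ p : X, (⋂ i : ℕ, f^[i] '' Set.univ) = {p} := by
  constructor
  · intro h
    have hcompact : ∀ i, IsCompact (f^[i] '' Set.univ) := fun i =>
      isCompact_univ.image (hf.iterate i)
    obtain ⟨p, hp⟩ := IsCompact.nonempty_iInter_of_sequence_nonempty_isCompact_isClosed
      (fun i : ℕ => f^[i] '' Set.univ) (fun i => antitone_iterate_image_univ f i.le_succ)
      (fun i => Set.univ_nonempty.image _) (hcompact 0) fun i => (hcompact i).isClosed
    exact ⟨p, (iInter_iterate_image_subsingleton hf h).eq_singleton_of_mem hp⟩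
  · rintro ⟨p, hp⟩
    exact chainContinuousAt_of_iInter_eq_singleton hf hp
end

section
/- Let X be a compact metric space and f : X → X a continuous map such that: (i) every point of X is a shadowable point for f; (ii) for every x ∈ X, ω_f(x) is contained in the union of all minimal sets for f; and (iii) for every x ∈ X, the chain component C_f(x) containing ω_f(x) is chain stable. Then f is chain continuous at every point of X. -/
open Filter Topology

variable {X : Type*} [MetricSpace X]

section ChainLemmas

/-- Two `δ`-chains with matching endpoints can be concatenated. -/
theorem IsDeltaChain.append {f : X → X} {δ : ℝ} {c c' : ℕ → X} {k k' : ℕ}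
    (h : IsDeltaChain f δ c k) (h' : IsDeltaChain f δ c' k') (hcc' : c k = c' 0) :
    IsDeltaChain f δ (fun n => if n ≤ k then c n else c' (n - k)) (k + k') := by
  refine ⟨by have := h.1; omega, fun i hi => ?_⟩
  rcases lt_trichotomy i k with hik | rfl | hik
  · have h1 : i + 1 ≤ k := hik
    simpa [hik.le, h1] using h.2 i hik
  · have := h'.2 0 h'.1
    simpa [hcc'] using this
  · have h1 : ¬ i ≤ k := by omega
    have h2 : ¬ i + 1 ≤ k := by omega
    have h3 : i + 1 - k = i - k + 1 := by omega
    simpa [h1, h2, h3] using h'.2 (i - k) (by omega)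

/-- Blocks of the same length which are `δ`-chains with matching endpoints form a
`δ`-pseudo orbit. -/
theorem dist_blocks_le {f : X → X} {δ : ℝ} {N : ℕ} {c : ℕ → ℕ → X}
    (hc : ∀ q, IsDeltaChain f δ (c q) N) (hend : ∀ q, c q N = c (q + 1) 0) (n : ℕ) :
    dist (f (c (n / N) (n % N))) (c ((n + 1) / N) ((n + 1) % N)) ≤ δ := by
  have hN : 0 < N := (hc 0).1
  have hr : n % N < N := Nat.mod_lt _ hN
  have hstep := (hc (n / N)).2 (n % N) hr
  have hn : n + 1 = (n % N + 1) + N * (n / N) := by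
    have := Nat.mod_add_div n N
    omega
  rcases Nat.lt_or_ge (n % N + 1) N with h | h
  · have h1 : (n + 1) / N = n / N := by
      rw [hn, Nat.add_mul_div_left _ _ hN, Nat.div_eq_of_lt h, zero_add]
    have h2 : (n + 1) % N = n % N + 1 := by
      rw [hn, Nat.add_mul_mod_self_left, Nat.mod_eq_of_lt h]
    rwa [h1, h2]
  · have h0 : n % N + 1 = N := by omega
    have h1 : (n + 1) / N = n / N + 1 := by
      rw [hn, h0, Nat.add_mul_div_left _ _ hN, Nat.div_self hN, add_comm]
    have h2 : (n + 1) % N = 0 := by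
      rw [hn, h0, Nat.add_mul_mod_self_left, Nat.mod_self]
    rw [h1, h2, ← hend]
    rwa [h0] at hstep

/-- Pseudo orbits from `x` are close to the orbit of `x` for a fixed finite time. -/
theorem exists_pseudoOrbit_close_upto {f : X → X} (hf : Continuous f) (x : X) (k : ℕ) :
    ∀ ε > 0, ∃ δ > 0, ∀ xs : ℕ → X, (∀ i, dist (f (xs i)) (xs (i + 1)) ≤ δ) →
      xs 0 = x → ∀ i ≤ k, dist (xs i) (f^[i] x) ≤ ε := by
  induction k with
  | zero =>
    intro ε hε
    refine ⟨1, one_pos, fun xs _ h0 i hi => ?_⟩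
    obtain rfl : i = 0 := by omega
    simpa [h0] using hε.le
  | succ k ih =>
    intro ε hε
    obtain ⟨η, hη, hηf⟩ := Metric.continuous_iff.1 hf (f^[k] x) (ε / 2) (half_pos hε)
    obtain ⟨δ, hδ, H⟩ := ih (min ε (η / 2)) (lt_min hε (half_pos hη))
    refine ⟨min δ (ε / 2), lt_min hδ (half_pos hε), fun xs hxs h0 i hi => ?_⟩
    have H' := H xs (fun i => (hxs i).trans (min_le_left _ _)) h0
    rcases Nat.lt_or_ge k i with hik | hik
    · obtain rfl : i = k + 1 := by omega
      have h1 := hηf (xs k) (by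
        have := (H' k le_rfl).trans (min_le_right _ _)
        linarith)
      have h2 := (hxs k).trans (min_le_right _ _)
      rw [Function.iterate_succ_apply']
      have h3 := dist_triangle_left (xs (k + 1)) (f (f^[k] x)) (f (xs k))
      linarith
    · exact (H' i hik).trans (min_le_left _ _)

/-- A point of its own ω-limit set returns near itself along multiples of any `N ≥ 1`. -/
theorem exists_mul_return {f : X → X} (hf : Continuous f) {w : X}
    (hw : w ∈ omegaLimitPt f w) {N : ℕ} (hN : 1 ≤ N) {U : Set X} (hU : U ∈ 𝓝 w) :
    ∃ m, 1 ≤ m ∧ f^[m * N] w ∈ U := by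
  let S : ℕ → Prop := fun j => ∀ U ∈ 𝓝 w, ∃ m, 1 ≤ m ∧ m % N = j % N ∧ f^[m] w ∈ U
  have hadd : ∀ j k, S j → S k → S (j + k) := by
    intro j k hj hk V hV
    obtain ⟨m₁, hm₁, hmod₁, hV₁⟩ := hj (interior V) (interior_mem_nhds.2 hV)
    have hV' : f^[m₁] ⁻¹' V ∈ 𝓝 w :=
      (hf.iterate m₁).continuousAt (mem_interior_iff_mem_nhds.1 hV₁)
    obtain ⟨m₂, hm₂, hmod₂, hV₂⟩ := hk _ hV'
    refine ⟨m₁ + m₂, by omega, ?_, ?_⟩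
    · rw [Nat.add_mod, hmod₁, hmod₂, ← Nat.add_mod]
    · rw [Function.iterate_add_apply]
      exact hV₂
  have hex : ∃ j, S j := by
    by_contra! hno
    simp only [S, not_forall] at hno
    choose V hV hVno using hno
    obtain ⟨φ, hφ, hlim⟩ := hw
    have hI : (⋂ j ∈ Finset.range N, V j) ∈ 𝓝 w :=
      (biInter_finset_mem _).2 fun j _ => hV j
    obtain ⟨t, ht, htI⟩ := ((eventually_ge_atTop 1).and (hlim.eventually hI)).exists
    have hlt : φ t % N < N := Nat.mod_lt _ hN
    refine hVno (φ t % N) ⟨φ t, ht.trans hφ.le_apply, (Nat.mod_mod _ _).symm, ?_⟩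
    exact Set.mem_iInter₂.1 htI _ (Finset.mem_range.2 hlt)
  obtain ⟨j, hj⟩ := hex
  have hmul : ∀ n, S ((n + 1) * j) := by
    intro n
    induction n with
    | zero => simpa using hj
    | succ n ih =>
      rw [Nat.succ_mul]
      exact hadd _ _ ih hj
  obtain ⟨m, hm, hmod, hmU⟩ := hmul (N - 1) U hU
  rw [Nat.sub_add_cancel hN, Nat.mul_mod_right] at hmod
  obtain ⟨q, rfl⟩ := Nat.dvd_of_mod_eq_zero hmod
  refine ⟨q, ?_, by rwa [mul_comm]⟩
  rcases Nat.eq_zero_or_pos q with rfl | h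
  · simp at hm
  · exact h

theorem chainReach_self_of_mem_omegaLimitPt {f : X → X} {p : X}
    (hp : p ∈ omegaLimitPt f p) : ChainReach f p p := by
  intro δ hδ
  obtain ⟨φ, hφ, hlim⟩ := hp
  obtain ⟨t, ht, htd⟩ :=
    ((eventually_ge_atTop 1).and (hlim.eventually (Metric.ball_mem_nhds p hδ))).exists
  have hk : 1 ≤ φ t := ht.trans hφ.le_apply
  refine ⟨fun i => if i = φ t then p else f^[i] p, φ t, ⟨hk, fun i hi => ?_⟩, ?_, by simp⟩
  · simp only [hi.ne, if_false]
    rw [← Function.iterate_succ_apply' f i p]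
    split_ifs with h
    · rw [← h] at htd
      exact (Metric.mem_ball.1 htd).le
    · simpa using hδ.le
  · simp [show ¬ 0 = φ t by omega]

/-- If the chain component of `p` is chain stable and contains `p`, then fine enough chains from
`p` end at points from which there is a `δ`-chain back to `p`. -/
theorem exists_chain_return [CompactSpace X] {f : X → X} (hf : Continuous f) {p : X}
    (hp : ChainReach f p p) (hst : ChainStable f (chainComponent f p)) {δ : ℝ} (hδ : 0 < δ) :
    ∃ δ' > 0, ∀ c k, IsDeltaChain f δ' c k → c 0 = p →
      ∃ c' k', IsDeltaChain f δ c' k' ∧ c' 0 = c k ∧ c' k' = p := by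
  by_contra! hno
  choose c k hc hc0 hcno using fun n : ℕ => hno (1 / ((n : ℝ) + 1)) Nat.one_div_pos_of_nat
  obtain ⟨z, -, φ, hφ, hlim⟩ :=
    isCompact_univ.tendsto_subseq (x := fun n => c n (k n)) fun n => Set.mem_univ _
  have hpz : ChainReach f p z := by
    intro ρ hρ
    have h1 : ∀ᶠ n in atTop, 1 / ((φ n : ℝ) + 1) < ρ / 2 :=
      (tendsto_one_div_add_atTop_nhds_zero_nat.comp hφ.tendsto_atTop).eventually
        (gt_mem_nhds (half_pos hρ))
    obtain ⟨n, hn1, hn2⟩ :=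
      (h1.and (hlim.eventually (Metric.ball_mem_nhds z (half_pos hρ)))).exists
    have hn2 : dist (c (φ n) (k (φ n))) z < ρ / 2 := hn2
    have hk := (hc (φ n)).1
    refine ⟨fun i => if i = k (φ n) then z else c (φ n) i, k (φ n), ⟨hk, fun i hi => ?_⟩,
      ?_, by simp⟩
    · have h2 := (hc (φ n)).2 i hi
      simp only [hi.ne, if_false]
      split_ifs with h
      · rw [h] at h2
        have := dist_triangle (f (c (φ n) i)) (c (φ n) (k (φ n))) z
        linarith
      · linarith
    · simp [show ¬ 0 = k (φ n) by omega, hc0]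
  obtain ⟨c', k', hc', hc'0, hc'k⟩ := (hst p ⟨hp, hp⟩ z hpz).2 (δ / 2) (half_pos hδ)
  have hflim : Tendsto (fun n => f (c (φ n) (k (φ n)))) atTop (𝓝 (f z)) :=
    (hf.tendsto z).comp hlim
  obtain ⟨n, hn⟩ := (hflim.eventually (Metric.ball_mem_nhds (f z) (half_pos hδ))).exists
  have hn : dist (f (c (φ n) (k (φ n)))) (f z) < δ / 2 := hn
  refine hcno (φ n) (fun i => if i = 0 then c (φ n) (k (φ n)) else c' i) k'
    ⟨hc'.1, fun i hi => ?_⟩ (by simp) ?_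
  · have h2 := hc'.2 i hi
    rcases Nat.eq_zero_or_pos i with rfl | h
    · rw [hc'0] at h2
      have := dist_triangle (f (c (φ n) (k (φ n)))) (f z) (c' (0 + 1))
      simp only [if_true]
      simp only [zero_add, one_ne_zero, if_false] at *
      linarith
    · simp only [h.ne', if_false, Nat.succ_ne_zero]
      linarith
  · have := hc'.1
    simp [show ¬ k' = 0 by omega, hc'k]

/-- If every ω-limit point is recurrent, then two `δ`-chains from `p` to `p` of the same length
cannot diverge, provided that `δ`-pseudo orbits from `p` are shadowed. -/
theorem dist_le_of_loops [CompactSpace X] {f : X → X} (hf : Continuous f)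
    (hrec : ∀ x, ∀ w ∈ omegaLimitPt f x, w ∈ omegaLimitPt f w) {p : X} {δ η : ℝ} (hη : 0 < η)
    (hsh : ∀ xs : ℕ → X, (∀ i, dist (f (xs i)) (xs (i + 1)) ≤ δ) →
      xs 0 = p → ∃ y, ∀ i, dist (xs i) (f^[i] y) ≤ η)
    {A B : ℕ → X} {N : ℕ} (hA : IsDeltaChain f δ A N) (hB : IsDeltaChain f δ B N)
    (hA0 : A 0 = p) (hAN : A N = p) (hB0 : B 0 = p) (hBN : B N = p) {i : ℕ} (hi : i < N) :
    dist (B i) (A i) ≤ 3 * η := by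
  classical
  have hN : 0 < N := hA.1
  let c : ℕ → ℕ → X := fun q => if ∃ l, q = 2 ^ l then B else A
  have hc : ∀ q, IsDeltaChain f δ (c q) N := by
    intro q
    simp only [c]
    split_ifs <;> assumption
  have hc0 : ∀ q, c q 0 = p := by
    intro q
    simp only [c]
    split_ifs <;> assumption
  have hcN : ∀ q, c q N = p := by
    intro q
    simp only [c]
    split_ifs <;> assumption
  obtain ⟨y, hy⟩ := hsh (fun n => c (n / N) (n % N))
    (dist_blocks_le hc fun q => by rw [hcN, hc0]) (by simp [hc0])
  have hblock : ∀ q, dist (c q i) (f^[q * N + i] y) ≤ η := by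
    intro q
    have h1 : (q * N + i) / N = q := by
      rw [mul_comm, Nat.mul_add_div hN, Nat.div_eq_of_lt hi, add_zero]
    have h2 : (q * N + i) % N = i := by
      rw [mul_comm, Nat.mul_add_mod, Nat.mod_eq_of_lt hi]
    simpa only [h1, h2] using hy (q * N + i)
  obtain ⟨w, -, φ, hφ, hlim⟩ := isCompact_univ.tendsto_subseq
    (x := fun l : ℕ => f^[2 ^ l * N] y) fun n => Set.mem_univ _
  have hmono : StrictMono fun j => 2 ^ φ j * N := fun a b hab =>
    Nat.mul_lt_mul_of_pos_right (Nat.pow_lt_pow_right (by norm_num) (hφ hab)) hN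
  have hw : w ∈ omegaLimitPt f w := hrec y w ⟨_, hmono, hlim⟩
  have htrans : ∀ m, Tendsto (fun j => f^[(2 ^ φ j + m) * N + i] y) atTop
      (𝓝 (f^[m * N + i] w)) := by
    intro m
    refine (((hf.iterate (m * N + i)).tendsto w).comp hlim).congr fun j => ?_
    simp only [Function.comp_apply]
    rw [← Function.iterate_add_apply]
    congr 1
    ring_nf
  have hBw : dist (B i) (f^[i] w) ≤ η := by
    have h1 := htrans 0
    simp only [add_zero, zero_mul, zero_add] at h1
    refine le_of_tendsto (tendsto_const_nhds.dist h1) (Eventually.of_forall fun j => ?_)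
    have h2 := hblock (2 ^ φ j)
    simpa only [c, if_pos (⟨φ j, rfl⟩ : ∃ l, 2 ^ φ j = 2 ^ l)] using h2
  have hAw : ∀ m, 1 ≤ m → dist (A i) (f^[m * N + i] w) ≤ η := by
    intro m hm
    refine le_of_tendsto (tendsto_const_nhds.dist (htrans m)) ?_
    filter_upwards [eventually_ge_atTop m] with j hj
    have h2 := hblock (2 ^ φ j + m)
    have h3 : ¬ ∃ l, 2 ^ φ j + m = 2 ^ l := by
      rintro ⟨l, hl⟩
      have hlt : m < 2 ^ φ j := (hj.trans hφ.le_apply).trans_lt Nat.lt_two_pow_self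
      have h4 : φ j < l := (Nat.pow_lt_pow_iff_right (a := 2) (by norm_num)).1 (by omega)
      have h5 : l < φ j + 1 := by
        refine (Nat.pow_lt_pow_iff_right (a := 2) (by norm_num)).1 ?_
        rw [pow_succ]
        omega
      omega
    simpa only [c, if_neg h3] using h2
  have hU : f^[i] ⁻¹' Metric.ball (f^[i] w) η ∈ 𝓝 w :=
    (hf.iterate i).continuousAt (Metric.ball_mem_nhds _ hη)
  obtain ⟨m, hm, hmU⟩ := exists_mul_return hf hw hN hU
  have h1 : dist (f^[m * N + i] w) (f^[i] w) < η := by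
    rw [add_comm, Function.iterate_add_apply]
    exact hmU
  have h2 := hAw m hm
  have h3 := dist_triangle4 (B i) (f^[i] w) (f^[m * N + i] w) (A i)
  rw [dist_comm (f^[i] w), dist_comm (f^[m * N + i] w) (A i)] at h3
  linarith

/-- A shadowable recurrent point with chain stable chain component is a point of chain continuity
if all ω-limit points are recurrent. -/
theorem chainContinuousAt_of_recurrent [CompactSpace X] {f : X → X} (hf : Continuous f)
    (hrec : ∀ x, ∀ w ∈ omegaLimitPt f x, w ∈ omegaLimitPt f w) {p : X}
    (hsh : ShadowablePoint f p) (hp : p ∈ omegaLimitPt f p)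
    (hst : ChainStable f (chainComponent f p)) : ChainContinuousAt f p := by
  intro ε hε
  obtain ⟨δ, hδ, hδsh⟩ := hsh (ε / 3) (by positivity)
  obtain ⟨δ', hδ', hret⟩ :=
    exists_chain_return hf (chainReach_self_of_mem_omegaLimitPt hp) hst hδ
  refine ⟨min δ δ', lt_min hδ hδ', fun xs hxs h0 i => ?_⟩
  rcases Nat.eq_zero_or_pos i with rfl | hi
  · simpa [h0] using hε.le
  have horb : ∀ ρ > 0, IsDeltaChain f ρ (fun n => f^[n] p) i := fun ρ hρ =>
    ⟨hi, fun j _ => by simpa [← Function.iterate_succ_apply'] using hρ.le⟩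
  obtain ⟨b, k, hb, hb0, hbk⟩ :=
    hret xs i ⟨hi, fun j _ => (hxs j).trans (min_le_right _ _)⟩ h0
  obtain ⟨a, l, ha, ha0, hal⟩ := hret (fun n => f^[n] p) i (horb δ' hδ') rfl
  have hxsδ : IsDeltaChain f δ xs i := ⟨hi, fun j _ => (hxs j).trans (min_le_left _ _)⟩
  have hB := hxsδ.append hb hb0.symm
  have hA := (horb δ hδ).append ha ha0.symm
  have hk := hb.1
  have hl := ha.1
  have hBA := hB.append hA (by simp [show ¬ k = 0 by omega, hbk])
  have hAB := hA.append hB (by simp [show ¬ l = 0 by omega, hal, h0])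
  rw [add_comm (i + k)] at hBA
  have key := dist_le_of_loops hf hrec (by positivity) hδsh hAB hBA (i := i)
    (by simp) (by simp [show ¬ k = 0 by omega, hbk])
    (by simp [h0]) (by simp [show ¬ l = 0 by omega, hal])
    (by omega)
  simp only [Nat.le_add_right, le_refl, if_true] at key
  linarith

/-- Chain continuity passes from an ω-limit point of `x` to `x`. -/
theorem ChainContinuousAt.of_mem_omegaLimitPt {f : X → X} (hf : Continuous f) {x p : X}
    (hp : p ∈ omegaLimitPt f x) (hcc : ChainContinuousAt f p) : ChainContinuousAt f x := by
  intro ε hε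
  obtain ⟨δ₀, hδ₀, H⟩ := hcc (ε / 2) (half_pos hε)
  obtain ⟨η, hη, hηf⟩ := Metric.continuous_iff.1 hf p (δ₀ / 2) (half_pos hδ₀)
  obtain ⟨φ, -, hlim⟩ := hp
  obtain ⟨t, ht⟩ := (hlim.eventually (Metric.ball_mem_nhds p (half_pos hη))).exists
  have ht : dist (f^[φ t] x) p < η / 2 := ht
  obtain ⟨δ, hδ, Hfin⟩ := exists_pseudoOrbit_close_upto hf x (φ t) (min ε (η / 4))
    (lt_min hε (by positivity))
  have track : ∀ ys : ℕ → X, (∀ i, dist (f (ys i)) (ys (i + 1)) ≤ δ₀ / 2) →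
      dist (ys (φ t)) p < η → ∀ i, dist (ys (φ t + (i + 1))) (f^[i + 1] p) ≤ ε / 2 := by
    intro ys hys hyp i
    have := H (fun i => if i = 0 then p else ys (φ t + i)) (fun j => ?_) (by simp) (i + 1)
    · simpa using this
    · rcases Nat.eq_zero_or_pos j with rfl | hj
      · have h1 := hηf _ hyp
        have h2 := hys (φ t)
        have h3 := dist_triangle_left (f p) (ys (φ t + 1)) (f (ys (φ t)))
        simp only [if_true, zero_add, one_ne_zero, if_false]
        linarith
      · simp only [hj.ne', if_false, Nat.succ_ne_zero]
        have := hys (φ t + j)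
        rw [add_assoc] at this
        linarith
  refine ⟨min δ (δ₀ / 2), lt_min hδ (half_pos hδ₀), fun xs hxs h0 i => ?_⟩
  have Hx := Hfin xs (fun i => (hxs i).trans (min_le_left _ _)) h0
  rcases Nat.lt_or_ge (φ t) i with hi | hi
  · obtain ⟨j, rfl⟩ : ∃ j, i = φ t + (j + 1) := ⟨i - φ t - 1, by omega⟩
    have h1 := track xs (fun i => (hxs i).trans (min_le_right _ _)) (by
      have h2 := (Hx _ le_rfl).trans (min_le_right _ _)
      have h3 := dist_triangle (xs (φ t)) (f^[φ t] x) p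
      linarith) j
    have h2 := track (fun n => f^[n] x)
      (fun n => by simpa [← Function.iterate_succ_apply'] using (half_pos hδ₀).le) (by linarith) j
    have h3 := dist_triangle_right (xs (φ t + (j + 1))) (f^[φ t + (j + 1)] x) (f^[j + 1] p)
    linarith
  · exact (Hx i hi).trans (min_le_left _ _)

end ChainLemmas

theorem stmt13 [CompactSpace X] (f : X → X) (hf : Continuous f)
    (hsh : ∀ x : X, ShadowablePoint f x)
    (hmin : ∀ x : X, omegaLimitPt f x ⊆ ⋃₀ {M : Set X | IsMinimalSet f M})
    (hter : ∀ x : X, ∀ p ∈ omegaLimitPt f x, ChainStable f (chainComponent f p)) :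
    ∀ x : X, ChainContinuousAt f x := by
  intro x
  have hrec : ∀ x, ∀ w ∈ omegaLimitPt f x, w ∈ omegaLimitPt f w := by
    intro x w hw
    obtain ⟨M, hM, hwM⟩ := hmin x hw
    exact (hM.2.2.2 w hwM).symm ▸ hwM
  obtain ⟨p, -, φ, hφ, hlim⟩ :=
    isCompact_univ.tendsto_subseq (x := fun n => f^[n] x) fun n => Set.mem_univ _
  have hp : p ∈ omegaLimitPt f x := ⟨φ, hφ, hlim⟩
  exact ChainContinuousAt.of_mem_omegaLimitPt hf hp
    (chainContinuousAt_of_recurrent hf hrec (hsh p) (hrec x p hp) (hter x p hp))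
end

section
/- Let X be a compact metric space and f : X → X a continuous surjective map that is chain continuous at every point of X. Then every point of X is chain recurrent, i.e., X = CR(f). -/
open Filter Topology

variable {X : Type*} [MetricSpace X]

/-- A continuous map that is chain continuous at `z` has equicontinuous iterates at `z`. -/
theorem ChainContinuousAt.exists_dist_iterate_le {f : X → X} (hf : Continuous f) {z : X}
    (hz : ChainContinuousAt f z) {ε : ℝ} (hε : 0 < ε) :
    ∃ η > 0, ∀ y, dist y z < η → ∀ n : ℕ, 1 ≤ n → dist (f^[n] y) (f^[n] z) ≤ ε := by
  obtain ⟨δ, hδ, h⟩ := hz ε hε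
  obtain ⟨η, hη, hcont⟩ := Metric.continuous_iff.1 hf z δ hδ
  refine ⟨η, hη, fun y hy n hn => ?_⟩
  have key := h (fun i => if i = 0 then z else f^[i] y) (fun i => ?_) (by simp) n
  · simpa [Nat.one_le_iff_ne_zero.1 hn] using key
  · rcases Nat.eq_zero_or_pos i with rfl | hi
    · simpa [dist_comm] using (hcont y hy).le
    · simp [hi.ne', Function.iterate_succ_apply', hδ.le]

/-- A point to which its forward orbit returns arbitrarily closely is chain recurrent. -/
theorem mem_chainRecurrent_of_dist_iterate_le {f : X → X} {x : X}
    (h : ∀ δ > 0, ∃ k : ℕ, 1 ≤ k ∧ dist (f^[k] x) x ≤ δ) : x ∈ chainRecurrent f := by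
  intro δ hδ
  obtain ⟨k, hk, hkx⟩ := h δ hδ
  refine ⟨fun i => if i = k then x else f^[i] x, k, ⟨hk, fun i hi => ?_⟩, by simp, by simp⟩
  by_cases hik : i + 1 = k
  · subst hik
    simpa [Function.iterate_succ_apply'] using hkx
  · simp [hi.ne, hik, Function.iterate_succ_apply', hδ.le]

theorem stmt14 [CompactSpace X] (f : X → X) (hf : Continuous f)
    (hsurj : Function.Surjective f) (hcc : ∀ x : X, ChainContinuousAt f x) :
    ∀ x : X, x ∈ chainRecurrent f := by
  intro x
  refine mem_chainRecurrent_of_dist_iterate_le fun δ hδ => ?_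
  have hs : Function.LeftInverse f (Function.surjInv hsurj) := Function.rightInverse_surjInv hsurj
  set g : ℕ → X := fun n => (Function.surjInv hsurj)^[n] x
  have hg : ∀ n, f^[n] (g n) = x := fun n => hs.iterate n x
  obtain ⟨z, φ, hφ, hlim⟩ := CompactSpace.tendsto_subseq g
  obtain ⟨η, hη, hequi⟩ := (hcc z).exists_dist_iterate_le hf (half_pos hδ)
  obtain ⟨N, hN⟩ := Metric.tendsto_atTop.1 hlim η hη
  have hlt : φ N < φ (N + 1) := hφ N.lt_succ_self
  obtain ⟨k, hk⟩ := Nat.exists_eq_add_of_lt hlt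
  have hreturn : f^[φ (N + 1)] (g (φ N)) = f^[k + 1] x := by
    rw [show φ (N + 1) = (k + 1) + φ N by lia, Function.iterate_add_apply, hg]
  have h₁ := hequi _ (hN N le_rfl) (φ (N + 1)) (by lia)
  have h₂ := hequi _ (hN (N + 1) N.le_succ) (φ (N + 1)) (by lia)
  simp only [Function.comp_apply, hreturn, hg] at h₁ h₂
  refine ⟨k + 1, by lia, ?_⟩
  linarith [dist_triangle_right (f^[k + 1] x) x (f^[φ (N + 1)] z)]
end
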